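/- (Strict area estimate for translating solitons, the case λ = 0.) Let D ⊆ ℝ² be a nonempty bounded open set whose boundary ∂D is a C¹ curve, and let u : ℝ² → ℝ be twice continuously differentiable on a neighborhood of the closure of D, equal to 0 at every point of ∂D, and satisfy the 0-soliton graph equation on D (the translating-soliton equation). Let h := sup_{x ∈ D} |u(x)| and A := ∫_D √(1 + ‖∇u(x)‖²) dx. Then 4π·h < A. -/

import Mathlib

open MeasureTheory

noncomputable section

/-- The Euclidean plane. -/
abbrev E2 := EuclideanSpace ℝ (Fin 2)

/-- `W u x = √(1 + ‖∇u(x)‖²)`. -/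
noncomputable def W (u : E2 → ℝ) (x : E2) : ℝ := Real.sqrt (1 + ‖gradient u x‖ ^ 2)

/-- The divergence of a vector field `X : ℝ² → ℝ²`: `div X = ∂₁X₁ + ∂₂X₂`. -/
noncomputable def div2 (X : E2 → E2) (x : E2) : ℝ :=
  ∑ i : Fin 2, fderiv ℝ X x (EuclideanSpace.single i 1) i

/-- `u` satisfies the λ-soliton graph equation on the open set `D`: `u` is C² on `D` and
`div (∇u / W(u)) = 2λ + 1/W(u)` at every point of `D`. -/
def SatisfiesSolitonEq (lam : ℝ) (D : Set E2) (u : E2 → ℝ) : Prop :=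
  ContDiffOn ℝ 2 u D ∧
    ∀ x ∈ D, div2 (fun y => (W u y)⁻¹ • gradient u y) x = 2 * lam + (W u x)⁻¹

end

/-- `s` is a closed regular C¹ curve in the plane: the image of a periodic, regular,
C¹ parametrization which is injective on a fundamental period. -/
def IsC1ClosedCurve (s : Set E2) : Prop :=
  ∃ γ : ℝ → E2, ContDiff ℝ 1 γ ∧ Function.Periodic γ 1 ∧
    Set.InjOn γ (Set.Ico (0 : ℝ) 1) ∧ (∀ t : ℝ, deriv γ t ≠ 0) ∧ Set.range γ = s

section Soliton

open Set Filter Topology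

/-- One-dimensional Brunn–Minkowski inequality, where one of the sets is an interval. -/
lemma volume_add_le_of_interval_subset {S T : Set ℝ} {r : ℝ} (hr : 0 ≤ r) (hS : S.Nonempty)
    (hSb : BddAbove S) (h : ∀ a ∈ S, ∀ z, |z - a| ≤ r → z ∈ T) :
    volume S + ENNReal.ofReal (2 * r) ≤ volume T := by
  rcases hr.eq_or_lt with rfl | hr
  · simpa using measure_mono (μ := volume) fun a ha => h a ha a (by simp)
  have hsub : (fun x => x + r) ⁻¹' S ∪ Ioo (sSup S - r) (sSup S + r) ⊆ T := by
    rintro z (hz | ⟨hz1, hz2⟩)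
    · exact h _ hz z (by simp [abs_of_pos hr])
    · obtain ⟨a, ha, hza⟩ := exists_lt_of_lt_csSup hS
        (max_lt (by linarith) (by linarith) : max (z - r) (sSup S - 2 * r) < sSup S)
      have hle := le_csSup hSb ha
      have h1 := (le_max_left _ _).trans_lt hza
      by_cases hz3 : a ≤ z + r
      · exact h a ha z (abs_le.2 ⟨by linarith, by linarith⟩)
      · linarith
  have hdisj : Disjoint ((fun x => x + r) ⁻¹' S) (Ioo (sSup S - r) (sSup S + r)) := by
    refine disjoint_left.2 fun z hz hz' => ?_
    have := le_csSup hSb hz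
    linarith [hz'.1]
  calc volume S + ENNReal.ofReal (2 * r)
      = volume ((fun x => x + r) ⁻¹' S ∪ Ioo (sSup S - r) (sSup S + r)) := by
        rw [measure_union hdisj measurableSet_Ioo, measure_preimage_add_right, Real.volume_Ioo]
        congr 2
        ring
    _ ≤ volume T := measure_mono hsub

lemma lintegral_sqrt_one_sub_sq {ε : ℝ} (hε : 0 ≤ ε) :
    ∫⁻ t in Ioo (0 : ℝ) 1, ENNReal.ofReal (2 * (ε * √(1 - t ^ 2))) =
      ENNReal.ofReal (ε * (Real.pi / 2)) := by
  have hInt : ∀ a b : ℝ, IntervalIntegrable (fun t : ℝ => √(1 - t ^ 2)) volume a b := fun a b =>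
    Continuous.intervalIntegrable (by fun_prop) _ _
  have hhalf : ∫ t in (0 : ℝ)..1, √(1 - t ^ 2) = Real.pi / 4 := by
    have h1 := integral_sqrt_one_sub_sq
    rw [← intervalIntegral.integral_add_adjacent_intervals (hInt (-1) 0) (hInt 0 1)] at h1
    have h2 := intervalIntegral.integral_comp_neg (a := 0) (b := 1) fun t : ℝ => √(1 - t ^ 2)
    simp only [neg_sq, neg_zero] at h2
    linarith
  rw [← ofReal_integral_eq_lintegral_ofReal]
  · congr 1
    rw [← integral_Ioc_eq_integral_Ioo, ← intervalIntegral.integral_of_le zero_le_one]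
    simp only [intervalIntegral.integral_const_mul, hhalf]
    ring
  · exact (Continuous.integrableOn_Icc (by fun_prop)).mono_set Ioo_subset_Icc_self
  · exact .of_forall fun t => by positivity

lemma isBounded_fiber {A : Set (ℝ × ℝ)} (hA : Bornology.IsBounded A) (x : ℝ) :
    Bornology.IsBounded (Prod.mk x ⁻¹' A) :=
  hA.image_snd.subset fun y hy => ⟨(x, y), hy, rfl⟩

lemma volume_prod_eq_lintegral_fiber {A : Set (ℝ × ℝ)} (hA : MeasurableSet A)
    (hAb : Bornology.IsBounded A) :
    volume A = ∫⁻ x, ENNReal.ofReal (volume.real (Prod.mk x ⁻¹' A)) := by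
  rw [Measure.volume_eq_prod, Measure.prod_apply hA]
  refine lintegral_congr fun x => (ofReal_measureReal ?_).symm
  exact (isBounded_fiber hAb x).measure_lt_top.ne

/-- Brunn–Minkowski inequality in the plane, where one of the sets is a disc. -/
lemma brunn_minkowski_disc {A C : Set (ℝ × ℝ)} (hA : MeasurableSet A) (hC : MeasurableSet C)
    (hAb : Bornology.IsBounded A) (hCb : Bornology.IsBounded C) {ε : ℝ} (hε : 0 < ε)
    (h : ∀ p ∈ A, ∀ q : ℝ × ℝ, (q.1 - p.1) ^ 2 + (q.2 - p.2) ^ 2 ≤ ε ^ 2 → q ∈ C) :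
    volume.real A + 2 * ε * √(Real.pi * volume.real A) ≤ volume.real C := by
  have hAC : A ⊆ C := fun p hp => h p hp p (by simp; positivity)
  rcases (measureReal_nonneg (μ := volume) (s := A)).eq_or_lt with h0 | hApos
  · simp [← h0]
  obtain ⟨R, hR⟩ := hAb.subset_closedBall 0
  have hmem : ∀ p ∈ A, |p.1| ≤ R ∧ |p.2| ≤ R := fun p hp => by
    have := hR hp
    rw [mem_closedBall_zero_iff, Prod.norm_def] at this
    exact max_le_iff.1 this
  set a : ℝ → ℝ := fun x => volume.real (Prod.mk x ⁻¹' A) with ha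
  set c : ℝ → ℝ := fun x => volume.real (Prod.mk x ⁻¹' C) with hc
  have ham : Measurable a := (measurable_measure_prodMk_left hA).ennreal_toReal
  have hcm : Measurable c := (measurable_measure_prodMk_left hC).ennreal_toReal
  have hane : ∀ x, 0 < a x → (Prod.mk x ⁻¹' A).Nonempty := fun x hx => by
    by_contra hne
    rw [not_nonempty_iff_eq_empty] at hne
    simp [ha, hne] at hx
  have habd : BddAbove (range a) := by
    refine ⟨volume.real (Icc (-R) R), ?_⟩
    rintro _ ⟨x, rfl⟩
    exact measureReal_mono (fun y hy => abs_le.1 (hmem _ hy).2) (by simp)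
  set α : ℝ := ⨆ x, a x
  have haα : ∀ x, a x ≤ α := le_ciSup habd
  have hαpos : 0 < α := by
    by_contra hneg
    have hz : volume A = 0 := by
      rw [volume_prod_eq_lintegral_fiber hA hAb]
      have : ∀ x, ENNReal.ofReal (a x) = 0 := fun x =>
        ENNReal.ofReal_eq_zero.2 ((haα x).trans (not_lt.1 hneg))
      simp only [ha] at this
      simp [this]
    simp [measureReal_def, hz] at hApos
  have hAfin : volume A ≠ ⊤ := hAb.measure_lt_top.ne
  have hCfin : volume C ≠ ⊤ := hCb.measure_lt_top.ne
  have hβ : 0 < α + 2 * ε := by positivity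
  have hA1 : volume A / ENNReal.ofReal α = ∫⁻ t in Ioo (0 : ℝ) 1, volume {x | t < a x / α} := by
    have hlay := lintegral_eq_lintegral_meas_lt volume (f := fun x => a x / α)
      (.of_forall fun x => div_nonneg measureReal_nonneg hαpos.le)
      (ham.div_const _).aemeasurable
    rw [volume_prod_eq_lintegral_fiber hA hAb, ENNReal.div_eq_inv_mul,
      ← lintegral_const_mul _ ham.ennreal_ofReal]
    calc _ = ∫⁻ x, ENNReal.ofReal (a x / α) := by
          refine lintegral_congr fun x => ?_
          rw [ENNReal.ofReal_div_of_pos hαpos, ENNReal.div_eq_inv_mul]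
      _ = _ := by
          rw [hlay, ← Ioo_union_Ici_eq_Ioi (zero_lt_one' ℝ), lintegral_union measurableSet_Ici]
          · rw [setLIntegral_congr_fun (g := fun _ => 0) measurableSet_Ici]
            · simp
            · intro t ht
              have : {x | t < a x / α} = ∅ := by
                refine eq_empty_iff_forall_notMem.2 fun x hx => ?_
                have h1 : a x / α ≤ 1 := (div_le_one hαpos).2 (haα x)
                exact absurd (lt_of_lt_of_le hx h1) (not_lt.2 ht)
              simp [this]
          · exact disjoint_left.2 fun t ht ht' => absurd ht.2 (not_lt.2 ht')
  have hC1 : ∫⁻ t in Ioo (0 : ℝ) 1, volume {x | t < c x / (α + 2 * ε)} ≤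
      volume C / ENNReal.ofReal (α + 2 * ε) := by
    have hlay := lintegral_eq_lintegral_meas_lt volume (f := fun x => c x / (α + 2 * ε))
      (.of_forall fun x => div_nonneg measureReal_nonneg hβ.le)
      (hcm.div_const _).aemeasurable
    rw [volume_prod_eq_lintegral_fiber hC hCb, ENNReal.div_eq_inv_mul,
      ← lintegral_const_mul _ hcm.ennreal_ofReal]
    calc _ ≤ ∫⁻ x, ENNReal.ofReal (c x / (α + 2 * ε)) := by
          rw [hlay]
          exact lintegral_mono_set Ioo_subset_Ioi_self
      _ = _ := by
          refine lintegral_congr fun x => ?_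
          rw [ENNReal.ofReal_div_of_pos hβ, ENNReal.div_eq_inv_mul]
  have hstep : ∀ t ∈ Ioo (0 : ℝ) 1, volume {x | t < a x / α} +
      ENNReal.ofReal (2 * (ε * √(1 - t ^ 2))) ≤ volume {x | t < c x / (α + 2 * ε)} := by
    rintro t ⟨ht0, ht1⟩
    refine volume_add_le_of_interval_subset (by positivity) ?_ ?_ ?_
    · obtain ⟨x, hx⟩ := exists_lt_of_lt_ciSup (show t * α < ⨆ x, a x by nlinarith)
      exact ⟨x, (lt_div_iff₀ hαpos).2 hx⟩
    · refine ⟨R, fun x hx => ?_⟩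
      have : 0 < a x := by
        have := (lt_div_iff₀ hαpos).1 hx
        nlinarith
      obtain ⟨y, hy⟩ := hane x this
      exact (abs_le.1 (hmem _ hy).1).2
    · intro x hx z hz
      have hx' : t * α < a x := (lt_div_iff₀ hαpos).1 hx
      have hzsq : (z - x) ^ 2 ≤ ε ^ 2 * (1 - t ^ 2) := by
        have h1 : (z - x) ^ 2 ≤ (ε * √(1 - t ^ 2)) ^ 2 := sq_le_sq' (abs_le.1 hz).1 (abs_le.1 hz).2
        rwa [mul_pow, Real.sq_sqrt (by nlinarith)] at h1
      have hfiber : volume (Prod.mk x ⁻¹' A) + ENNReal.ofReal (2 * (ε * t)) ≤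
          volume (Prod.mk z ⁻¹' C) := by
        refine volume_add_le_of_interval_subset (by positivity) (hane x (by nlinarith))
          (isBounded_fiber hAb x).bddAbove fun y hy w hw => h _ hy _ ?_
        have h2 : (w - y) ^ 2 ≤ (ε * t) ^ 2 := sq_le_sq' (abs_le.1 hw).1 (abs_le.1 hw).2
        dsimp only
        nlinarith
      have hreal : a x + 2 * (ε * t) ≤ c z := by
        have h3 := ENNReal.toReal_mono (isBounded_fiber hCb z).measure_lt_top.ne hfiber
        rwa [ENNReal.toReal_add (isBounded_fiber hAb x).measure_lt_top.ne ENNReal.ofReal_ne_top,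
          ENNReal.toReal_ofReal (by positivity)] at h3
      exact (lt_div_iff₀ hβ).2 (by nlinarith)
  have hmain : volume A / ENNReal.ofReal α + ENNReal.ofReal (ε * (Real.pi / 2)) ≤
      volume C / ENNReal.ofReal (α + 2 * ε) := by
    rw [hA1, ← lintegral_sqrt_one_sub_sq hε.le, ← lintegral_add_right _ (by fun_prop)]
    exact (setLIntegral_mono' measurableSet_Ioo hstep).trans hC1
  have hmain' : volume.real A / α + ε * (Real.pi / 2) ≤ volume.real C / (α + 2 * ε) := by
    have h4 := ENNReal.toReal_mono (ENNReal.div_ne_top hCfin (by simpa using hβ)) hmain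
    rwa [ENNReal.toReal_add (ENNReal.div_ne_top hAfin (by simpa using hαpos))
      ENNReal.ofReal_ne_top, ENNReal.toReal_div, ENNReal.toReal_div,
      ENNReal.toReal_ofReal hαpos.le, ENNReal.toReal_ofReal hβ.le,
      ENNReal.toReal_ofReal (by positivity)] at h4
  rw [le_div_iff₀ hβ] at hmain'
  set s := √(Real.pi * volume.real A) with hs
  have hs2 : s ^ 2 = Real.pi * volume.real A := Real.sq_sqrt (by positivity)
  have hpi := Real.pi_pos
  have hAs : volume.real A = s ^ 2 / Real.pi := by rw [hs2]; field_simp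
  have hkey : 0 ≤ 2 / (α * Real.pi) * (s - α * Real.pi / 2) ^ 2 := by positivity
  have hexp : 2 / (α * Real.pi) * (s - α * Real.pi / 2) ^ 2 =
      2 * (volume.real A / α) + α * Real.pi / 2 - 2 * s := by
    rw [hAs]
    field_simp
    ring
  have hfin : volume.real A / α * α = volume.real A := div_mul_cancel₀ _ hαpos.ne'
  nlinarith [mul_nonneg hε.le hkey, mul_pos hε (mul_pos hε hpi)]

/-- Brunn–Minkowski inequality in the Euclidean plane, where one of the sets is a disc. -/
lemma brunn_minkowski_closedBall {A C : Set E2} (hA : MeasurableSet A) (hC : MeasurableSet C)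
    (hAb : Bornology.IsBounded A) (hCb : Bornology.IsBounded C) {ε : ℝ} (hε : 0 < ε)
    (h : ∀ p ∈ A, ∀ q, dist q p ≤ ε → q ∈ C) :
    volume.real A + 2 * ε * √(Real.pi * volume.real A) ≤ volume.real C := by
  let e : E2 ≃ᵐ ℝ × ℝ :=
    (MeasurableEquiv.toLp 2 (Fin 2 → ℝ)).symm.trans MeasurableEquiv.finTwoArrow
  have he : MeasurePreserving e volume volume :=
    (volume_preserving_finTwoArrow ℝ).comp
      (EuclideanSpace.volume_preserving_symm_measurableEquiv_toLp (Fin 2))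
  have hcoord : ∀ p, (e.symm p) 0 = p.1 ∧ (e.symm p) 1 = p.2 := fun p => ⟨rfl, rfl⟩
  have hvol : ∀ B : Set E2, volume.real (e.symm ⁻¹' B) = volume.real B := fun B => by
    rw [measureReal_def, (he.symm e).measure_preimage_equiv, measureReal_def]
  have hbdd : ∀ {B : Set E2}, Bornology.IsBounded B →
      Bornology.IsBounded (e.symm ⁻¹' B) := fun {B} hB => by
    obtain ⟨R, hR⟩ := hB.subset_closedBall 0
    refine Metric.isBounded_closedBall (x := (0 : ℝ × ℝ)) (r := R) |>.subset fun p hp => ?_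
    have h1 := hR hp
    rw [mem_closedBall_zero_iff] at h1 ⊢
    have h2 := fun i => (PiLp.norm_apply_le (e.symm p) i).trans h1
    rw [Prod.norm_def]
    exact max_le (by simpa [hcoord] using h2 0) (by simpa [hcoord] using h2 1)
  have hmain := brunn_minkowski_disc (e.symm.measurable hA) (e.symm.measurable hC) (hbdd hAb)
    (hbdd hCb) hε fun p hp q hq => h _ hp (e.symm q) <| by
      rw [EuclideanSpace.dist_eq, Fin.sum_univ_two]
      refine Real.sqrt_le_iff.2 ⟨hε.le, ?_⟩
      simpa only [hcoord, Real.dist_eq, sq_abs] using hq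
  rwa [hvol, hvol] at hmain

/-- The sharp isoperimetric inequality in functional form: the total variation of a nonnegative
compactly supported `C¹` function which is at least `c` on `K`. -/
lemma isoperimetric_le_integral_norm_fderiv {f : E2 → ℝ} (hf : ContDiff ℝ 1 f)
    (hfc : HasCompactSupport f) (hf0 : ∀ x, 0 ≤ f x) {c : ℝ} (hc : 0 < c) {K : Set E2}
    (hK : ∀ x ∈ K, c ≤ f x) :
    2 * c * √(Real.pi * volume.real K) ≤ ∫ x, ‖fderiv ℝ f x‖ := by
  have hf' : Continuous (fderiv ℝ f) := hf.continuous_fderiv one_ne_zero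
  have hfc' : HasCompactSupport (fderiv ℝ f) := hfc.fderiv (𝕜 := ℝ)
  set S : Set E2 := Metric.cthickening 1 (tsupport f) with hS
  have hSc : IsCompact S := hfc.isCompact.cthickening
  have hsuppS : tsupport f ⊆ S := Metric.self_subset_cthickening _
  have hSfin : volume S ≠ ⊤ := hSc.measure_lt_top.ne
  suffices hω : ∀ ω > 0, 2 * c * √(Real.pi * volume.real K) ≤
      (∫ x, ‖fderiv ℝ f x‖) + ω * volume.real S by
    have hlim : Tendsto (fun ω : ℝ => (∫ x, ‖fderiv ℝ f x‖) + ω * volume.real S) (𝓝[>] 0)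
        (𝓝 ((∫ x, ‖fderiv ℝ f x‖) + 0 * volume.real S)) :=
      (Continuous.tendsto (by fun_prop) 0).mono_left nhdsWithin_le_nhds
    rw [zero_mul, add_zero] at hlim
    exact ge_of_tendsto hlim (eventually_nhdsWithin_of_forall hω)
  intro ω hω
  obtain ⟨δ, hδ, hunif⟩ := Metric.uniformContinuous_iff.1
    (hfc'.uniformContinuous_of_continuous hf') ω hω
  set ε := min (δ / 2) 1
  have hε : 0 < ε := by positivity
  have hε1 : ε ≤ 1 := min_le_right _ _
  have hεδ : ε < δ := (min_le_left _ _).trans_lt (by linarith)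
  set g : E2 → ℝ := fun x => f x + ε * (‖fderiv ℝ f x‖ + S.indicator (fun _ => ω) x) with hg
  have hSm : MeasurableSet S := hSc.isClosed.measurableSet
  have hind0 : ∀ x, 0 ≤ S.indicator (fun _ => ω) x := fun x =>
    indicator_nonneg (fun _ _ => hω.le) x
  have hg0 : ∀ x, 0 ≤ g x := fun x =>
    add_nonneg (hf0 x) (mul_nonneg hε.le (add_nonneg (norm_nonneg _) (hind0 x)))
  have hgm : Measurable g := by
    have : Measurable (S.indicator fun _ => ω) := measurable_const.indicator hSm
    exact hf.continuous.measurable.add ((hf'.norm.measurable.add this).const_mul _)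
  have hfg : ∀ p q, dist q p ≤ ε → f p ≤ g q := by
    intro p q hpq
    by_cases hq : q ∈ S
    · have hmv := (convex_closedBall q ε).norm_image_sub_le_of_norm_fderiv_le (𝕜 := ℝ) (f := f)
        (C := ‖fderiv ℝ f q‖ + ω) (fun x _ => hf.differentiable one_ne_zero x)
        (fun x hx => ?_) (Metric.mem_closedBall_self hε.le)
        (Metric.mem_closedBall.2 (dist_comm q p ▸ hpq) : p ∈ _)
      · have h1 : ‖p - q‖ ≤ ε := by rwa [← dist_eq_norm, dist_comm]
        have h2 := (le_abs_self _).trans hmv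
        have h3 : (‖fderiv ℝ f q‖ + ω) * ‖p - q‖ ≤ (‖fderiv ℝ f q‖ + ω) * ε := by gcongr
        simp only [hg, indicator_of_mem hq]
        linarith
      · have h4 := hunif ((Metric.mem_closedBall.1 hx).trans_lt hεδ)
        rw [dist_eq_norm] at h4
        have := norm_le_norm_add_norm_sub' (fderiv ℝ f x) (fderiv ℝ f q)
        linarith
    · have hp : p ∉ tsupport f := fun hp =>
        hq (Metric.mem_cthickening_of_dist_le _ _ _ _ hp (hpq.trans hε1))
      rw [image_eq_zero_of_notMem_tsupport hp]
      exact hg0 q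
  have hgS : ∀ x ∉ S, g x = 0 := fun x hx => by
    have h1 : x ∉ tsupport f := fun h => hx (hsuppS h)
    have h2 : fderiv ℝ f x = 0 := by
      by_contra h
      exact h1 (support_fderiv_subset ℝ h)
    simp [hg, hx, image_eq_zero_of_notMem_tsupport h1, h2]
  have hlevel : ∀ s ∈ Ioi (0 : ℝ), volume {x | s < f x} +
      (Ioo 0 c).indicator (fun _ => ENNReal.ofReal (2 * ε * √(Real.pi * volume.real K))) s ≤
      volume {x | s < g x} := by
    intro s hs
    have hfS : {x | s < f x} ⊆ S := fun x hx => by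
      by_contra h
      have h1 : x ∉ tsupport f := fun h' => h (hsuppS h')
      rw [mem_ofPred_eq, image_eq_zero_of_notMem_tsupport h1] at hx
      exact absurd hx (not_lt.2 (mem_Ioi.1 hs).le)
    have hgS' : {x | s < g x} ⊆ S := fun x hx => by
      by_contra h
      rw [mem_ofPred_eq, hgS x h] at hx
      exact absurd hx (not_lt.2 (mem_Ioi.1 hs).le)
    have hfb := hSc.isBounded.subset hfS
    have hgb := hSc.isBounded.subset hgS'
    by_cases hsc : s ∈ Ioo 0 c
    · rw [indicator_of_mem hsc]
      have hbm := brunn_minkowski_closedBall (A := {x | s < f x}) (C := {x | s < g x})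
        (measurableSet_lt measurable_const hf.continuous.measurable)
        (measurableSet_lt measurable_const hgm) hfb hgb hε
        fun p hp q hq => lt_of_lt_of_le hp (hfg p q hq)
      have hKs : volume.real K ≤ volume.real {x | s < f x} :=
        measureReal_mono (fun x hx => hsc.2.trans_le (hK x hx)) hfb.measure_lt_top.ne
      rw [← ofReal_measureReal (μ := volume) (s := {x | s < f x}) hfb.measure_lt_top.ne,
        ← ofReal_measureReal (μ := volume) (s := {x | s < g x}) hgb.measure_lt_top.ne,
        ← ENNReal.ofReal_add measureReal_nonneg (by positivity)]
      refine ENNReal.ofReal_le_ofReal (le_trans ?_ hbm)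
      gcongr
    · rw [indicator_of_notMem hsc, add_zero]
      exact measure_mono fun x hx => lt_of_lt_of_le hx (hfg x x (by simpa using hε.le))
  have hfint : Integrable f := hf.continuous.integrable_of_hasCompactSupport hfc
  have hf'int : Integrable fun x => ‖fderiv ℝ f x‖ :=
    (hf'.integrable_of_hasCompactSupport hfc').norm
  have hindint : Integrable (S.indicator fun _ => ω) :=
    (integrable_indicator_iff hSm).2 (integrableOn_const hSfin)
  have hgint : Integrable g := hfint.add ((hf'int.add hindint).const_mul ε)
  have hlint : (∫⁻ x, ENNReal.ofReal (f x)) +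
      ENNReal.ofReal (2 * ε * √(Real.pi * volume.real K)) * ENNReal.ofReal c ≤
      ∫⁻ x, ENNReal.ofReal (g x) := by
    rw [lintegral_eq_lintegral_meas_lt volume (.of_forall hf0) hf.continuous.aemeasurable,
      lintegral_eq_lintegral_meas_lt volume (.of_forall hg0) hgm.aemeasurable]
    have hconst : ∫⁻ s in Ioi (0 : ℝ), (Ioo 0 c).indicator
        (fun _ => ENNReal.ofReal (2 * ε * √(Real.pi * volume.real K))) s =
        ENNReal.ofReal (2 * ε * √(Real.pi * volume.real K)) * ENNReal.ofReal c := by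
      rw [lintegral_indicator_const measurableSet_Ioo, Measure.restrict_apply measurableSet_Ioo,
        inter_eq_left.2 Ioo_subset_Ioi_self, Real.volume_Ioo, sub_zero]
    rw [← hconst, ← lintegral_add_right _ (measurable_const.indicator measurableSet_Ioo)]
    exact setLIntegral_mono' measurableSet_Ioi hlevel
  rw [← ofReal_integral_eq_lintegral_ofReal hfint (.of_forall hf0),
    ← ofReal_integral_eq_lintegral_ofReal hgint (.of_forall hg0),
    ← ENNReal.ofReal_mul (by positivity),
    ← ENNReal.ofReal_add (integral_nonneg hf0) (by positivity),
    ENNReal.ofReal_le_ofReal_iff (integral_nonneg hg0)] at hlint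
  have hgval : ∫ x, g x = (∫ x, f x) + ε * ((∫ x, ‖fderiv ℝ f x‖) + ω * volume.real S) := by
    have hsum : Integrable fun x => ‖fderiv ℝ f x‖ + S.indicator (fun _ => ω) x :=
      hf'int.add hindint
    simp only [hg]
    rw [integral_add hfint (hsum.const_mul ε), integral_const_mul, integral_add hf'int hindint, integral_indicator_const _ hSm, smul_eq_mul, mul_comm ω]
  rw [hgval] at hlint
  refine le_of_mul_le_mul_left ?_ hε
  linarith

lemma integral_div2_eq_zero {Y : E2 → E2} (hY : ContDiff ℝ 1 Y) (hYc : HasCompactSupport Y) :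
    ∫ x, div2 Y x = 0 := by
  have hInt : ∀ v : E2, Integrable fun x => fderiv ℝ Y x v := fun v =>
    Continuous.integrable_of_hasCompactSupport
      ((hY.continuous_fderiv one_ne_zero).clm_apply continuous_const)
      (hYc.fderiv_apply (𝕜 := ℝ) v)
  have hzero : ∀ v : E2, ∫ x, fderiv ℝ Y x v = 0 := fun v => by
    have := integral_smul_fderiv_eq_neg_fderiv_smul_of_integrable (μ := (volume : Measure E2))
      (f := fun _ => (1 : ℝ)) (g := Y) (v := v) (by simp) (by simpa using hInt v)
      (by simpa using hY.continuous.integrable_of_hasCompactSupport hYc) (by simp)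
      (fun x _ => hY.differentiable one_ne_zero x)
    simpa using this
  have hcomp : ∀ (v : E2) (i : Fin 2), Integrable (fun x => fderiv ℝ Y x v i) ∧
      ∫ x, fderiv ℝ Y x v i = 0 := fun v i => by
    refine ⟨(EuclideanSpace.proj (𝕜 := ℝ) i).integrable_comp (hInt v), ?_⟩
    have := (EuclideanSpace.proj (𝕜 := ℝ) i).integral_comp_comm (hInt v)
    rw [hzero] at this
    simpa using this
  unfold div2
  rw [integral_finsetSum _ fun i _ => (hcomp _ i).1]
  simp [(hcomp _ _).2]

/-- A `C¹` approximation of the truncation `s ↦ min (max (s - a) 0) (b - a)`. -/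
lemma exists_smooth_truncation {a b δ : ℝ} (hδ : 0 < δ) (hδab : δ < b - a) :
    ∃ φ ψ : ℝ → ℝ, Continuous ψ ∧ (∀ s, HasDerivAt φ (ψ s) s) ∧ (∀ s, 0 ≤ ψ s) ∧
      (∀ s, ψ s ≤ 1) ∧ (∀ s, s ≤ a → ψ s = 0) ∧ (∀ s, b ≤ s → ψ s = 0) ∧
      (∀ s, s ≤ a → φ s = 0) ∧ (∀ s, 0 ≤ φ s) ∧ (∀ s, φ s ≤ b - a) ∧
      ∀ s, b ≤ s → b - a - δ ≤ φ s := by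
  let ψ : ℝ → ℝ := fun s => max 0 (min 1 (2 / δ * min (s - a) (b - s)))
  have hψ : Continuous ψ := by fun_prop
  have hInt : ∀ x y, IntervalIntegrable ψ volume x y := hψ.intervalIntegrable
  have hψ0 : ∀ s, 0 ≤ ψ s := fun s => le_max_left _ _
  have hψ1 : ∀ s, ψ s ≤ 1 := fun s => max_le zero_le_one (min_le_left _ _)
  have hψa : ∀ s, s ≤ a → ψ s = 0 := fun s hs => max_eq_left <| (min_le_right _ _).trans <|
    mul_nonpos_of_nonneg_of_nonpos (by positivity) ((min_le_left _ _).trans (by linarith))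
  have hψb : ∀ s, b ≤ s → ψ s = 0 := fun s hs => max_eq_left <| (min_le_right _ _).trans <|
    mul_nonpos_of_nonneg_of_nonpos (by positivity) ((min_le_right _ _).trans (by linarith))
  let φ : ℝ → ℝ := fun s => ∫ t in a..s, ψ t
  have hadd : ∀ x y, φ x + ∫ t in x..y, ψ t = φ y := fun x y =>
    intervalIntegral.integral_add_adjacent_intervals (hInt _ _) (hInt _ _)
  have hmono : Monotone φ := fun x y hxy => by
    rw [← hadd x y]
    have := intervalIntegral.integral_nonneg (μ := volume) hxy fun t _ => hψ0 t
    linarith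
  have hφa : ∀ s, s ≤ a → φ s = 0 := fun s hs => by
    have h0 : ∫ t in a..s, ψ t = ∫ t in a..s, (0 : ℝ) :=
      intervalIntegral.integral_congr fun t ht => hψa t (by
        rw [uIcc_of_ge hs] at ht
        exact ht.2)
    simpa [φ] using h0
  have hφb : ∀ s, b ≤ s → φ s = φ b := fun s hs => by
    have h0 : ∫ t in b..s, ψ t = ∫ t in b..s, (0 : ℝ) :=
      intervalIntegral.integral_congr fun t ht => hψb t (by
        rw [uIcc_of_le hs] at ht
        exact ht.1)
    rw [← hadd b s, h0]
    simp
  have hφ0 : ∀ s, 0 ≤ φ s := fun s => by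
    rw [← hφa _ (min_le_right s a)]
    exact hmono (min_le_left _ _)
  have hφle : φ b ≤ b - a := by
    have := intervalIntegral.integral_mono_on (by linarith : a ≤ b) (hInt a b)
      (intervalIntegrable_const (c := (1 : ℝ))) fun t _ => hψ1 t
    simpa [φ] using this
  have hφge : b - a - δ ≤ φ b := by
    have h1 := intervalIntegral.integral_mono_on (by linarith : a + δ / 2 ≤ b - δ / 2)
      (intervalIntegrable_const (c := (1 : ℝ))) (hInt _ _) fun t ht => by
        refine le_trans (le_min le_rfl ?_) (le_max_right _ _)
        have : δ / 2 ≤ min (t - a) (b - t) := le_min (by linarith [ht.1]) (by linarith [ht.2])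
        calc (1 : ℝ) = 2 / δ * (δ / 2) := by field_simp
          _ ≤ _ := by gcongr
    have h2 := hadd (a + δ / 2) (b - δ / 2)
    have h3 := hφ0 (a + δ / 2)
    have h4 : φ (b - δ / 2) ≤ φ b := hmono (by linarith)
    simp only [intervalIntegral.integral_const, smul_eq_mul, mul_one] at h1
    linarith
  refine ⟨φ, ψ, hψ, fun s => ?_, hψ0, hψ1, hψa, hψb, hφa, hφ0, fun s => ?_, fun s hs => ?_⟩
  · exact intervalIntegral.integral_hasDerivAt_right (hInt _ _)
      hψ.stronglyMeasurable.stronglyMeasurableAtFilter hψ.continuousAt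
  · refine (hmono (le_max_left s b)).trans ?_
    rwa [hφb _ (le_max_right s b)]
  · rwa [hφb s hs]

section Domain

variable {D : Set E2} {u : E2 → ℝ}

lemma contDiff_indicator_comp_smul {F : Type*} [NormedAddCommGroup F] [NormedSpace ℝ F]
    (hDopen : IsOpen D) (hDbdd : Bornology.IsBounded D) (huc : ContinuousOn u (closure D))
    (hzero : ∀ x ∈ frontier D, u x = 0) (hu : ContDiffOn ℝ 1 u D) {φ : ℝ → ℝ}
    (hφ : ContDiff ℝ 1 φ) {a : ℝ} (ha : 0 < a) (hφa : ∀ s, |s| ≤ a → φ s = 0) {G : E2 → F}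
    (hG : ContDiffOn ℝ 1 G D) :
    ContDiff ℝ 1 (D.indicator fun x => φ (u x) • G x) ∧
      HasCompactSupport (D.indicator fun x => φ (u x) • G x) ∧
      ∀ x ∉ D, (D.indicator fun x => φ (u x) • G x) =ᶠ[𝓝 x] 0 := by
  set K : Set E2 := {x ∈ closure D | a ≤ |u x|}
  have hclosed : IsClosed K := by
    have : K = closure D ∩ (fun x => |u x|) ⁻¹' Ici a := rfl
    rw [this]
    exact (continuous_abs.comp_continuousOn huc).preimage_isClosed_of_isClosed isClosed_closure
      isClosed_Ici
  have hK : IsCompact K := hDbdd.isCompact_closure.of_isClosed_subset hclosed fun x hx => hx.1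
  have hKD : K ⊆ D := fun x hx => by
    by_contra h
    have h0 := hzero x (by rw [hDopen.frontier_eq]; exact ⟨hx.1, h⟩)
    have := hx.2
    rw [h0, abs_zero] at this
    linarith
  have hoff : ∀ x ∉ K, (D.indicator fun x => φ (u x) • G x) x = 0 := fun x hx => by
    by_cases hxD : x ∈ D
    · have : |u x| ≤ a := by
        by_contra h
        exact hx ⟨subset_closure hxD, (not_le.1 h).le⟩
      rw [indicator_of_mem hxD, hφa _ this, zero_smul]
    · exact indicator_of_notMem hxD _
  have hev : ∀ x ∉ D, (D.indicator fun x => φ (u x) • G x) =ᶠ[𝓝 x] 0 := fun x hx => by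
    filter_upwards [hclosed.isOpen_compl.mem_nhds fun h => hx (hKD h)] with y hy
    exact hoff y hy
  refine ⟨contDiff_iff_contDiffAt.2 fun x => ?_, HasCompactSupport.intro hK hoff, hev⟩
  by_cases hx : x ∈ D
  · have hDx := hDopen.mem_nhds hx
    have h1 : ContDiffAt ℝ 1 (fun x => φ (u x) • G x) x :=
      (hφ.contDiffAt.comp x (hu.contDiffAt hDx)).smul (hG.contDiffAt hDx)
    refine h1.congr_of_eventuallyEq ?_
    filter_upwards [hDx] with y hy
    exact indicator_of_mem hy _
  · exact (contDiffAt_const (c := (0 : F))).congr_of_eventuallyEq (hev x hx)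

lemma W_pos (u : E2 → ℝ) (x : E2) : 0 < W u x := Real.sqrt_pos.2 (by positivity)

lemma one_le_W (u : E2 → ℝ) (x : E2) : 1 ≤ W u x :=
  Real.one_le_sqrt.2 (by nlinarith [sq_nonneg ‖gradient u x‖])

lemma contDiffOn_gradient (hDopen : IsOpen D) (hu : ContDiffOn ℝ 2 u D) :
    ContDiffOn ℝ 1 (gradient u) D :=
  (InnerProductSpace.toDual ℝ E2).symm.toContinuousLinearEquiv.contDiff.comp_contDiffOn
    (hu.fderiv_of_isOpen hDopen (by norm_num))

lemma contDiffOn_W {D : Set E2} (hDopen : IsOpen D) (hu : ContDiffOn ℝ 2 u D) :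
    ContDiffOn ℝ 1 (W u) D :=
  (contDiffOn_const.add ((contDiffOn_gradient hDopen hu).norm_sq ℝ)).sqrt fun x _ =>
    (by positivity : (0 : ℝ) < 1 + ‖gradient u x‖ ^ 2).ne'

/-- The soliton equation tested against `φ ∘ u`. -/
lemma integral_soliton_test (hDopen : IsOpen D) (hDbdd : Bornology.IsBounded D)
    (huc : ContinuousOn u (closure D)) (hzero : ∀ x ∈ frontier D, u x = 0)
    (hsol : SatisfiesSolitonEq 0 D u) {φ ψ : ℝ → ℝ} (hψ : Continuous ψ)
    (hφψ : ∀ s, HasDerivAt φ (ψ s) s) {a : ℝ} (ha : 0 < a) (hφa : ∀ s, |s| ≤ a → φ s = 0) :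
    ∫ x in D, (ψ (u x) * (‖gradient u x‖ ^ 2 / W u x) + φ (u x) / W u x) = 0 := by
  have hφ : ContDiff ℝ 1 φ := by
    refine contDiff_one_iff_deriv.2 ⟨fun s => (hφψ s).differentiableAt, ?_⟩
    rwa [funext fun s => (hφψ s).deriv]
  have hu1 : ContDiffOn ℝ 1 u D := hsol.1.of_le (by norm_num)
  have hX : ContDiffOn ℝ 1 (fun y => (W u y)⁻¹ • gradient u y) D :=
    ((contDiffOn_W hDopen hsol.1).inv fun x _ => (W_pos u x).ne').smul
      (contDiffOn_gradient hDopen hsol.1)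
  obtain ⟨hY, hYc, hYe⟩ :=
    contDiff_indicator_comp_smul hDopen hDbdd huc hzero hu1 hφ ha hφa hX
  have hset := setIntegral_eq_integral_of_forall_compl_eq_zero (μ := volume) (s := D)
    (f := div2 (D.indicator fun x => φ (u x) • (W u x)⁻¹ • gradient u x)) fun x hx => by
      simp [div2, (hYe x hx).fderiv_eq]
  rw [← integral_div2_eq_zero hY hYc, ← hset]
  refine setIntegral_congr_fun hDopen.measurableSet fun x hx => ?_
  have hDx := hDopen.mem_nhds hx
  have hev : (D.indicator fun x => φ (u x) • (W u x)⁻¹ • gradient u x) =ᶠ[𝓝 x]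
      fun x => φ (u x) • (W u x)⁻¹ • gradient u x := by
    filter_upwards [hDx] with y hy
    exact indicator_of_mem hy _
  have hud : DifferentiableAt ℝ u x := (hu1.contDiffAt hDx).differentiableAt one_ne_zero
  have hXd := (hX.contDiffAt hDx).differentiableAt one_ne_zero
  have hcomp : HasFDerivAt (fun x => φ (u x)) (ψ (u x) • fderiv ℝ u x) x :=
    (hφψ (u x)).comp_hasFDerivAt x hud.hasFDerivAt
  have hsum := (hcomp.smul hXd.hasFDerivAt).fderiv
  have heq := hsol.2 x hx
  have hgrad : ∀ i : Fin 2, fderiv ℝ u x (EuclideanSpace.single i 1) = gradient u x i := fun i => by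
    rw [← inner_gradient_left, EuclideanSpace.inner_single_right]
    simp
  have hnorm : ‖gradient u x‖ ^ 2 = gradient u x 0 ^ 2 + gradient u x 1 ^ 2 := by
    rw [EuclideanSpace.norm_sq_eq]
    simp
  simp only [div2, Fin.sum_univ_two] at heq ⊢
  rw [hev.fderiv_eq]
  have hsum' : fderiv ℝ (fun x => φ (u x) • (W u x)⁻¹ • gradient u x) x = _ := hsum
  rw [hsum']
  simp only [add_apply, smul_apply,
    ContinuousLinearMap.smulRight_apply, PiLp.add_apply, PiLp.smul_apply, smul_eq_mul, hgrad]
  rw [hnorm]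
  linear_combination (-φ (u x)) * heq

lemma measurableSet_superlevel (hDopen : IsOpen D) (hu : ContinuousOn u D) (t : ℝ) :
    MeasurableSet {x ∈ D | t ≤ -u x} := by
  have h : {x ∈ D | t ≤ -u x} = D \ (D ∩ (fun x => -u x) ⁻¹' Iio t) := by
    ext x
    simp only [mem_ofPred_eq, Set.mem_sdiff, mem_inter_iff, mem_preimage, mem_Iio, not_and, not_lt]
    tauto
  rw [h]
  exact hDopen.measurableSet.diff
    (hu.neg.isOpen_inter_preimage hDopen isOpen_Iio).measurableSet

/-- The area of the part of the graph between two heights, via the isoperimetric inequality. -/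
lemma strip_area_estimate (hDopen : IsOpen D) (hDbdd : Bornology.IsBounded D)
    (huc : ContinuousOn u (closure D)) (hzero : ∀ x ∈ frontier D, u x = 0)
    (hsol : SatisfiesSolitonEq 0 D u) (hW : IntegrableOn (W u) D) {a b : ℝ} (ha : 0 < a)
    (hab : a < b) :
    4 * Real.pi * (b - a) * volume.real {x ∈ D | b ≤ -u x} ≤
      ((∫ x in {x ∈ D | a ≤ -u x}, W u x) - ∫ x in {x ∈ D | b ≤ -u x}, W u x) *
        ∫ x in {x ∈ D | a ≤ -u x}, (W u x)⁻¹ := by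
  have hu1 : ContDiffOn ℝ 1 u D := hsol.1.of_le (by norm_num)
  have hucD : ContinuousOn u D := hu1.continuousOn
  have hWc : ContinuousOn (W u) D := (contDiffOn_W hDopen hsol.1).continuousOn
  have hgc : ContinuousOn (fun x => ‖gradient u x‖) D :=
    (contDiffOn_gradient hDopen hsol.1).continuousOn.norm
  have hgW : ∀ x, ‖gradient u x‖ ≤ W u x := fun x => Real.le_sqrt_of_sq_le (by linarith)
  have hgWW : ∀ x, ‖gradient u x‖ ^ 2 / W u x ≤ W u x := fun x => by
    rw [div_le_iff₀ (W_pos u x), ← sq]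
    exact pow_le_pow_left₀ (norm_nonneg _) (hgW x) 2
  have hΩm := measurableSet_superlevel hDopen hucD
  have hΩD : ∀ t, {x ∈ D | t ≤ -u x} ⊆ D := fun t x hx => hx.1
  have hDm := hDopen.measurableSet
  have hintD : ∀ {F : E2 → ℝ} {C : ℝ}, ContinuousOn F D → (∀ x ∈ D, |F x| ≤ C * W u x) →
      IntegrableOn F D := fun {F C} hF hFC =>
    Integrable.mono' (hW.const_mul C) (hF.aestronglyMeasurable hDm)
      ((ae_restrict_iff' hDm).2 (.of_forall hFC))
  have hinv1 : ∀ x, (W u x)⁻¹ ≤ 1 := fun x => inv_le_one_of_one_le₀ (one_le_W u x)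
  have hWinv : ∀ x, (W u x)⁻¹ ≤ W u x := fun x => (hinv1 x).trans (one_le_W u x)
  have hinvint : IntegrableOn (fun x => (W u x)⁻¹) D :=
    hintD (C := 1) (hWc.inv₀ fun x _ => (W_pos u x).ne') fun x _ => by
      rw [abs_of_pos (inv_pos.2 (W_pos u x)), one_mul]
      exact hWinv x
  set S := (∫ x in {x ∈ D | a ≤ -u x}, W u x) - ∫ x in {x ∈ D | b ≤ -u x}, W u x
  set I := ∫ x in {x ∈ D | a ≤ -u x}, (W u x)⁻¹ with hI
  set V := volume.real {x ∈ D | b ≤ -u x}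
  have hΩab : {x ∈ D | b ≤ -u x} ⊆ {x ∈ D | a ≤ -u x} := fun x hx => ⟨hx.1, hab.le.trans hx.2⟩
  have hSeq : S = ∫ x in {x ∈ D | a ≤ -u x} \ {x ∈ D | b ≤ -u x}, W u x :=
    (setIntegral_sdiff (hΩm b) (hW.mono_set (hΩD a)) hΩab).symm
  have key : ∀ δ ∈ Ioo 0 (b - a), 4 * Real.pi * (b - a - δ) ^ 2 * V ≤ S * ((b - a) * I) := by
    rintro δ ⟨hδ, hδab⟩
    obtain ⟨φ, ψ, hψ, hφψ, hψ0, hψ1, hψa, hψb, hφa, hφ0, hφle, hφge⟩ :=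
      exists_smooth_truncation hδ hδab
    have hφ : ContDiff ℝ 1 φ := by
      refine contDiff_one_iff_deriv.2 ⟨fun s => (hφψ s).differentiableAt, ?_⟩
      rwa [funext fun s => (hφψ s).deriv]
    have hψuc : ContinuousOn (fun x => ψ (-u x)) D := hψ.comp_continuousOn hucD.neg
    have hφuc : ContinuousOn (fun x => φ (-u x)) D := hφ.continuous.comp_continuousOn hucD.neg
    have hNint : IntegrableOn (fun x => ψ (-u x) * ‖gradient u x‖) D :=
      hintD (C := 1) (hψuc.mul hgc) fun x _ => by
        rw [abs_of_nonneg (mul_nonneg (hψ0 _) (norm_nonneg _))]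
        exact mul_le_mul (hψ1 _) (hgW x) (norm_nonneg _) zero_le_one
    have hPint : IntegrableOn (fun x => ψ (-u x) * W u x) D :=
      hintD (C := 1) (hψuc.mul hWc) fun x _ => by
        rw [abs_of_nonneg (mul_nonneg (hψ0 _) (W_pos u x).le)]
        exact mul_le_mul_of_nonneg_right (hψ1 _) (W_pos u x).le
    have hQint : IntegrableOn (fun x => ψ (-u x) * (‖gradient u x‖ ^ 2 / W u x)) D :=
      hintD (C := 1) (hψuc.mul ((hgc.pow 2).div hWc fun x _ => (W_pos u x).ne')) fun x _ => by
        have h0 : 0 ≤ ‖gradient u x‖ ^ 2 / W u x := div_nonneg (sq_nonneg _) (W_pos u x).le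
        rw [abs_of_nonneg (mul_nonneg (hψ0 _) h0)]
        exact mul_le_mul (hψ1 _) (hgWW x) h0 zero_le_one
    have hRint : IntegrableOn (fun x => φ (-u x) / W u x) D :=
      hintD (C := b - a) (hφuc.div hWc fun x _ => (W_pos u x).ne') fun x _ => by
        rw [abs_of_nonneg (div_nonneg (hφ0 _) (W_pos u x).le), div_eq_mul_inv]
        exact mul_le_mul (hφle _) (hWinv x) (inv_nonneg.2 (W_pos u x).le) (by linarith)
    set N := ∫ x in D, ψ (-u x) * ‖gradient u x‖
    set P := ∫ x in D, ψ (-u x) * W u x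
    set Q := ∫ x in D, ψ (-u x) * (‖gradient u x‖ ^ 2 / W u x)
    have hiso : 2 * (b - a - δ) * √(Real.pi * V) ≤ N := by
      have hφneg : ContDiff ℝ 1 fun s => φ (-s) := hφ.comp contDiff_neg
      obtain ⟨hf, hfc, hfe⟩ := contDiff_indicator_comp_smul hDopen hDbdd huc hzero hu1 hφneg ha
        (fun s hs => hφa _ (by linarith [(abs_le.1 hs).1])) (contDiffOn_const (c := (1 : ℝ)))
      have h1 := isoperimetric_le_integral_norm_fderiv (K := {x ∈ D | b ≤ -u x}) hf hfc
        (fun x => indicator_nonneg (fun y _ => by simpa using hφ0 _) x)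
        (c := b - a - δ) (by linarith) fun x hx => by
          rw [indicator_of_mem hx.1]
          simpa using hφge _ hx.2
      refine h1.trans_eq ?_
      have hset := setIntegral_eq_integral_of_forall_compl_eq_zero (μ := volume) (s := D)
        (f := fun x => ‖fderiv ℝ (D.indicator fun x => φ (-u x) • (1 : ℝ)) x‖) fun x hx => by
          rw [(hfe x hx).fderiv_eq]
          simp
      rw [← hset]
      refine setIntegral_congr_fun hDm fun x hx => ?_
      have hDx := hDopen.mem_nhds hx
      have hud : DifferentiableAt ℝ u x := (hu1.contDiffAt hDx).differentiableAt one_ne_zero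
      have hcomp : HasFDerivAt (fun x => φ (-u x)) (ψ (-u x) • -fderiv ℝ u x) x :=
        (hφψ (-u x)).comp_hasFDerivAt x hud.hasFDerivAt.neg
      have hev : (D.indicator fun x => φ (-u x) • (1 : ℝ)) =ᶠ[𝓝 x] fun x => φ (-u x) := by
        filter_upwards [hDx] with y hy
        rw [indicator_of_mem hy, smul_eq_mul, mul_one]
      beta_reduce
      rw [hev.fderiv_eq, hcomp.fderiv, norm_smul, norm_neg, Real.norm_of_nonneg (hψ0 _),
        ← toDual_gradient, LinearIsometryEquiv.norm_map]
    have hCS : N ^ 2 ≤ P * Q := by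
      have hdisc : discrim P (-2 * N) Q ≤ 0 := discrim_le_zero fun l => by
        have hsum : P * (l * l) + -2 * N * l + Q =
            ∫ x in D, (l ^ 2 * (ψ (-u x) * W u x) + -(2 * l) * (ψ (-u x) * ‖gradient u x‖) +
              ψ (-u x) * (‖gradient u x‖ ^ 2 / W u x)) := by
          have h12 : IntegrableOn (fun x => l ^ 2 * (ψ (-u x) * W u x) +
              -(2 * l) * (ψ (-u x) * ‖gradient u x‖)) D :=
            (hPint.const_mul _).add (hNint.const_mul _)
          rw [integral_add h12 hQint, integral_add (hPint.const_mul _) (hNint.const_mul _),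
            integral_const_mul, integral_const_mul]
          ring
        rw [hsum]
        refine integral_nonneg fun x => ?_
        have hWp := W_pos u x
        have : l ^ 2 * (ψ (-u x) * W u x) + -(2 * l) * (ψ (-u x) * ‖gradient u x‖) +
            ψ (-u x) * (‖gradient u x‖ ^ 2 / W u x) =
            ψ (-u x) * ((l * W u x - ‖gradient u x‖) ^ 2 / W u x) := by
          field_simp
          ring
        simp only [Pi.zero_apply, this]
        exact mul_nonneg (hψ0 _) (div_nonneg (sq_nonneg _) hWp.le)
      rw [discrim] at hdisc
      nlinarith
    have hPS : P ≤ S := by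
      rw [hSeq]
      have hsub : {x ∈ D | a ≤ -u x} \ {x ∈ D | b ≤ -u x} ⊆ D := fun x hx => hx.1.1
      have hm := (hΩm a).diff (hΩm b)
      have h2 := setIntegral_indicator (μ := volume) (s := D) hm (f := W u)
      rw [inter_eq_right.2 hsub] at h2
      rw [← h2]
      refine setIntegral_mono_on hPint (hW.indicator hm) hDm fun x hx => ?_
      by_cases hxS : x ∈ {x ∈ D | a ≤ -u x} \ {x ∈ D | b ≤ -u x}
      · rw [indicator_of_mem hxS]
        exact mul_le_of_le_one_left (W_pos u x).le (hψ1 _)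
      · rw [indicator_of_notMem hxS]
        have : ψ (-u x) = 0 := by
          by_contra hne
          refine hxS ⟨⟨hx, ?_⟩, fun hxb => hne (hψb _ hxb.2)⟩
          by_contra hlt
          exact hne (hψa _ (not_le.1 hlt).le)
        rw [this, zero_mul]
    have hQI : Q ≤ (b - a) * I := by
      have hQR : Q = ∫ x in D, φ (-u x) / W u x := by
        have htest := integral_soliton_test hDopen hDbdd huc hzero hsol
          (φ := fun s => -φ (-s)) (ψ := fun s => ψ (-s)) (by fun_prop)
          (fun s => ((hφψ (-s)).comp s (hasDerivAt_neg s)).neg.congr_deriv (by simp)) ha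
          fun s hs => by simp [hφa _ (by linarith [(abs_le.1 hs).1] : -s ≤ a)]
        simp only [neg_div, ← sub_eq_add_neg] at htest
        rw [integral_sub hQint hRint] at htest
        linarith
      rw [hQR, hI, ← integral_const_mul]
      have h2 := setIntegral_indicator (μ := volume) (s := D) (hΩm a)
        (f := fun x => (b - a) * (W u x)⁻¹)
      rw [inter_eq_right.2 (hΩD a)] at h2
      rw [← h2]
      refine setIntegral_mono_on hRint ((hinvint.const_mul _).indicator (hΩm a)) hDm
        fun x hx => ?_
      by_cases hxS : x ∈ {x ∈ D | a ≤ -u x}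
      · rw [indicator_of_mem hxS, div_eq_mul_inv]
        exact mul_le_mul_of_nonneg_right (hφle _) (inv_nonneg.2 (W_pos u x).le)
      · rw [indicator_of_notMem hxS, hφa _ (not_le.1 fun h => hxS ⟨hx, h⟩).le, zero_div]
    have hP0 : 0 ≤ P := integral_nonneg fun x => mul_nonneg (hψ0 _) (W_pos u x).le
    have hQ0 : 0 ≤ Q := integral_nonneg fun x =>
      mul_nonneg (hψ0 _) (div_nonneg (sq_nonneg _) (W_pos u x).le)
    calc 4 * Real.pi * (b - a - δ) ^ 2 * V = (2 * (b - a - δ) * √(Real.pi * V)) ^ 2 := by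
          rw [mul_pow, Real.sq_sqrt (mul_nonneg Real.pi_pos.le measureReal_nonneg)]
          ring
      _ ≤ N ^ 2 := pow_le_pow_left₀
          (mul_nonneg (by linarith) (Real.sqrt_nonneg _)) hiso 2
      _ ≤ P * Q := hCS
      _ ≤ S * ((b - a) * I) := mul_le_mul hPS hQI hQ0 (hP0.trans hPS)
  have hba : 0 < b - a := sub_pos.2 hab
  have hlim : Tendsto (fun δ : ℝ => 4 * Real.pi * (b - a - δ) ^ 2 * V) (𝓝[>] 0)
      (𝓝 (4 * Real.pi * (b - a - 0) ^ 2 * V)) :=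
    (Continuous.tendsto (by fun_prop) 0).mono_left nhdsWithin_le_nhds
  have hle := le_of_tendsto hlim (mem_of_superset (Ioo_mem_nhdsGT hba) key)
  refine le_of_mul_le_mul_left ?_ hba
  linarith

/-- Solutions with zero boundary values are nonpositive. -/
lemma soliton_nonpos (hDopen : IsOpen D) (hDbdd : Bornology.IsBounded D)
    (huc : ContinuousOn u (closure D)) (hzero : ∀ x ∈ frontier D, u x = 0)
    (hsol : SatisfiesSolitonEq 0 D u) (hW : IntegrableOn (W u) D) : ∀ x ∈ D, u x ≤ 0 := by
  intro x₀ hx₀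
  by_contra! hpos
  have hucD : ContinuousOn u D := hsol.1.continuousOn
  have hWc : ContinuousOn (W u) D := (contDiffOn_W hDopen hsol.1).continuousOn
  have hgc : ContinuousOn (fun x => ‖gradient u x‖) D :=
    (contDiffOn_gradient hDopen hsol.1).continuousOn.norm
  have hDm := hDopen.measurableSet
  set m := u x₀ with hm
  obtain ⟨φ, ψ, hψ, hφψ, hψ0, hψ1, -, -, hφa, hφ0, hφle, hφge⟩ :=
    exists_smooth_truncation (a := m / 3) (b := 2 * m / 3) (δ := m / 6) (by linarith)
      (by linarith)
  have hφc : Continuous φ := continuous_iff_continuousAt.2 fun s => (hφψ s).continuousAt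
  have htest := integral_soliton_test hDopen hDbdd huc hzero hsol hψ hφψ
    (by linarith : 0 < m / 3) fun s hs => hφa s ((le_abs_self s).trans hs)
  set F : E2 → ℝ := fun x => ψ (u x) * (‖gradient u x‖ ^ 2 / W u x) + φ (u x) / W u x with hF
  have hF1 : ∀ x, 0 ≤ ψ (u x) * (‖gradient u x‖ ^ 2 / W u x) := fun x =>
    mul_nonneg (hψ0 _) (div_nonneg (sq_nonneg _) (W_pos u x).le)
  have hF2 : ∀ x, 0 ≤ φ (u x) / W u x := fun x => div_nonneg (hφ0 _) (W_pos u x).le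
  have hF0 : ∀ x, 0 ≤ F x := fun x => add_nonneg (hF1 x) (hF2 x)
  have hFint : IntegrableOn F D := by
    refine Integrable.mono' (hW.const_mul (1 + m / 3)) (ContinuousOn.aestronglyMeasurable
      (((hψ.comp_continuousOn hucD).mul ((hgc.pow 2).div hWc fun x _ => (W_pos u x).ne')).add
        ((hφc.comp_continuousOn hucD).div hWc fun x _ => (W_pos u x).ne')) hDm)
      (.of_forall fun x => ?_)
    have hWp := W_pos u x
    have hW2 : W u x ^ 2 = 1 + ‖gradient u x‖ ^ 2 := Real.sq_sqrt (by positivity)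
    have h1 : ‖gradient u x‖ ^ 2 / W u x ≤ W u x := by
      rw [div_le_iff₀ hWp, ← sq, hW2]
      linarith
    have h2 : ψ (u x) * (‖gradient u x‖ ^ 2 / W u x) ≤ 1 * W u x :=
      mul_le_mul (hψ1 _) h1 (div_nonneg (sq_nonneg _) hWp.le) zero_le_one
    have h3 : φ (u x) / W u x ≤ m / 3 * W u x := by
      rw [div_le_iff₀ hWp]
      have := hφle (u x)
      nlinarith [one_le_W u x]
    rw [Real.norm_of_nonneg (hF0 x)]
    simp only [hF]
    linarith
  have hopen := hucD.isOpen_inter_preimage hDopen (isOpen_Ioi (a := 2 * m / 3))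
  have hposvol : 0 < volume (D ∩ u ⁻¹' Ioi (2 * m / 3)) :=
    hopen.measure_pos _ ⟨x₀, hx₀, by simp only [mem_preimage, mem_Ioi]; linarith⟩
  have hgt := (setIntegral_pos_iff_support_of_nonneg_ae (.of_forall hF0) hFint).2
    (hposvol.trans_le (measure_mono fun x hx => ⟨?_, hx.1⟩))
  · exact hgt.ne' htest
  · have h4 := hφge (u x) (le_of_lt hx.2)
    have h5 : 0 < φ (u x) / W u x := div_pos (by linarith) (W_pos u x)
    exact (add_pos_of_nonneg_of_pos (hF1 x) h5).ne'

end Domain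

/-- A discretized comparison principle: a lower bound on the decrease of `A`, up to an error which
telescopes over a uniform partition. -/
lemma mul_sub_le_of_telescoping {L A : ℝ → ℝ} {a b k : ℝ} (hab : a < b)
    (h : ∀ s t, a ≤ s → s < t → t ≤ b → k * (t - s) * (1 + L t - L s) ≤ A s - A t) :
    k * (b - a) ≤ A a - A b := by
  have hn : ∀ n : ℕ, 0 < n →
      k * (b - a) + k * (b - a) * (L b - L a) * (n : ℝ)⁻¹ ≤ A a - A b := by
    intro n hn
    have hn' : (0 : ℝ) < n := Nat.cast_pos.2 hn
    set η := (b - a) / n with hη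
    have hη0 : 0 < η := div_pos (sub_pos.2 hab) hn'
    have hηn : n * η = b - a := by rw [hη]; field_simp
    let p : ℕ → ℝ := fun i => a + i * η
    have hp0 : p 0 = a := by simp [p]
    have hpn : p n = b := by simp only [p, hηn]; ring
    have hstep : ∀ i ∈ Finset.range n,
        k * η + k * η * (L (p (i + 1)) - L (p i)) ≤ A (p i) - A (p (i + 1)) := by
      intro i hi
      have hi' : ((i : ℝ) + 1) ≤ n := by exact_mod_cast Finset.mem_range.1 hi
      have hdiff : p (i + 1) - p i = η := by simp only [p]; push_cast; ring
      have hle : p (i + 1) ≤ b := by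
        simp only [p]
        push_cast
        nlinarith
      have h1 := h (p i) (p (i + 1)) (le_add_of_nonneg_right (by positivity))
        (by linarith) hle
      rw [hdiff] at h1
      linarith
    have hsum := Finset.sum_le_sum hstep
    rw [Finset.sum_range_sub' (fun i => A (p i)), Finset.sum_add_distrib, Finset.sum_const,
      Finset.card_range, nsmul_eq_mul, ← Finset.mul_sum, Finset.sum_range_sub (fun i => L (p i)),
      hp0, hpn] at hsum
    calc k * (b - a) + k * (b - a) * (L b - L a) * (n : ℝ)⁻¹ =
        n * (k * η) + k * η * (L b - L a) := by
          rw [hη]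
          field_simp
      _ ≤ A a - A b := hsum
  have hlim : Tendsto (fun n : ℕ => k * (b - a) + k * (b - a) * (L b - L a) * (n : ℝ)⁻¹) atTop
      (𝓝 (k * (b - a) + k * (b - a) * (L b - L a) * 0)) :=
    (tendsto_inv_atTop_nhds_zero_nat.const_mul _).const_add _
  rw [mul_zero, add_zero] at hlim
  exact le_of_tendsto hlim (eventually_atTop.2 ⟨1, hn⟩)

/-- Strict area estimate for translating solitons (the case λ = 0): . -/
theorem area_estimate_translator
    (D : Set E2) (hD : D.Nonempty) (hDopen : IsOpen D) (hDbdd : Bornology.IsBounded D)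
    (hbdry : IsC1ClosedCurve (frontier D))
    (u : E2 → ℝ)
    (hreg : ∃ U : Set E2, IsOpen U ∧ closure D ⊆ U ∧ ContDiffOn ℝ 2 u U)
    (hzero : ∀ x ∈ frontier D, u x = 0)
    (hsol : SatisfiesSolitonEq 0 D u)
    (h A : ℝ)
    (hh : h = sSup ((fun x => |u x|) '' D))
    (hA : A = ∫ x in D, Real.sqrt (1 + ‖gradient u x‖ ^ 2)) :
    4 * Real.pi * h < A := by
  have hDm := hDopen.measurableSet
  obtain ⟨U, hU, hDU, huU⟩ := hreg
  have hWU : ContinuousOn (W u) (closure D) := (contDiffOn_W hU huU).continuousOn.mono hDU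
  have hW : IntegrableOn (W u) D :=
    (hWU.integrableOn_compact hDbdd.isCompact_closure).mono_set subset_closure
  have huc : ContinuousOn u (closure D) := huU.continuousOn.mono hDU
  have hucD : ContinuousOn u D := huc.mono subset_closure
  have hgc : ContinuousOn (gradient u) D := (contDiffOn_gradient hDopen hsol.1).continuousOn
  have hWc : ContinuousOn (W u) D := hWU.mono subset_closure
  have hDfin : volume D ≠ ⊤ := hDbdd.measure_lt_top.ne
  have hDvol : 0 < volume.real D := ENNReal.toReal_pos (hDopen.measure_pos _ hD).ne' hDfin
  have hinv1 : ∀ x, (W u x)⁻¹ ≤ 1 := fun x => inv_le_one_of_one_le₀ (one_le_W u x)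
  have hinv0 : ∀ x, 0 < (W u x)⁻¹ := fun x => inv_pos.2 (W_pos u x)
  have hone : IntegrableOn (fun _ => (1 : ℝ)) D := integrableOn_const hDfin
  have hinvint : IntegrableOn (fun x => (W u x)⁻¹) D :=
    Integrable.mono' hone
      ((hWc.inv₀ fun x _ => (W_pos u x).ne').aestronglyMeasurable hDm)
      (.of_forall fun x => by rw [Real.norm_of_nonneg (hinv0 x).le]; exact hinv1 x)
  have hAW : A = ∫ x in D, W u x := hA
  have hnonpos := soliton_nonpos hDopen hDbdd huc hzero hsol hW
  rcases le_or_gt h 0 with hh0 | hh0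
  · have h1 : volume.real D ≤ A := by
      rw [hAW]
      have := setIntegral_mono_on hone hW hDm fun x _ => one_le_W u x
      simpa using this
    nlinarith [Real.pi_pos]
  set Ω : ℝ → Set E2 := fun t => {x ∈ D | t ≤ -u x}
  have hΩD : ∀ t, Ω t ⊆ D := fun t x hx => hx.1
  have hΩanti : ∀ {s t}, s ≤ t → Ω t ⊆ Ω s := fun hst x hx => ⟨hx.1, hst.trans hx.2⟩
  have hΩfin : ∀ t, volume (Ω t) ≠ ⊤ := fun t => measure_ne_top_of_subset (hΩD t) hDfin
  have hbelow : ∀ t < h, ∃ x ∈ D, t < -u x := fun t ht => by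
    rw [hh] at ht
    obtain ⟨_, ⟨x, hx, rfl⟩, hxt⟩ := exists_lt_of_lt_csSup (hD.image _) ht
    exact ⟨x, hx, by rwa [← abs_of_nonpos (hnonpos x hx)]⟩
  have hlevel : ∀ t, IsOpen (D ∩ (fun x => -u x) ⁻¹' Ioi t) := fun t =>
    hucD.neg.isOpen_inter_preimage hDopen isOpen_Ioi
  have hVpos : ∀ t < h, 0 < volume.real (Ω t) := fun t ht => by
    obtain ⟨x, hx, hxt⟩ := hbelow t ht
    refine ENNReal.toReal_pos (ne_of_gt ?_) (hΩfin t)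
    exact ((hlevel t).measure_pos _ ⟨x, hx, hxt⟩).trans_le
      (measure_mono fun y hy => ⟨hy.1, le_of_lt hy.2⟩)
  set S : ℝ → ℝ := fun t => ∫ x in Ω t, W u x
  have hSanti : ∀ {s t}, s ≤ t → S t ≤ S s := fun {s t} hst =>
    setIntegral_mono_set (hW.mono_set (hΩD s)) (.of_forall fun x => (W_pos u x).le)
      (hΩanti hst).eventuallyLE
  have hSA : ∀ t, S t ≤ A := fun t => by
    rw [hAW]
    exact setIntegral_mono_set hW (.of_forall fun x => (W_pos u x).le) (hΩD t).eventuallyLE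
  have hS0 : ∀ t, 0 ≤ S t := fun t => integral_nonneg fun x => (W_pos u x).le
  have hstrip : ∀ {a b θ : ℝ}, 0 < a → a < b → b < h → 0 < θ →
      (∀ s, a ≤ s → s ≤ b → ∫ x in Ω s, (W u x)⁻¹ ≤ θ * volume.real (Ω s)) →
      4 * Real.pi / θ * (b - a) ≤ S a - S b := by
    intro a b θ ha hab hbh hθ hI
    refine mul_sub_le_of_telescoping (L := fun t => Real.log (volume.real (Ω t))) hab
      fun s t has hst htb => ?_
    have hVs := hVpos s (by linarith)
    have hVt := hVpos t (by linarith)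
    have hest := strip_area_estimate hDopen hDbdd huc hzero hsol hW (ha.trans_le has) hst
    have hlog : 1 + Real.log (volume.real (Ω t)) - Real.log (volume.real (Ω s)) ≤
        volume.real (Ω t) / volume.real (Ω s) := by
      have := Real.log_le_sub_one_of_pos (div_pos hVt hVs)
      rw [Real.log_div hVt.ne' hVs.ne'] at this
      linarith
    have hest' : 4 * Real.pi * (t - s) * volume.real (Ω t) ≤
        (S s - S t) * (θ * volume.real (Ω s)) :=
      hest.trans (mul_le_mul_of_nonneg_left (hI s has (hst.le.trans htb))
        (sub_nonneg.2 (hSanti hst.le)))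
    have hts := sub_pos.2 hst
    calc _ ≤ 4 * Real.pi / θ * (t - s) * (volume.real (Ω t) / volume.real (Ω s)) := by
          have := Real.pi_pos
          gcongr
      _ = 4 * Real.pi * (t - s) * volume.real (Ω t) / (θ * volume.real (Ω s)) := by
          field_simp
      _ ≤ S s - S t := (div_le_iff₀ (by positivity)).2 hest'
  have hIV : ∀ s, ∫ x in Ω s, (1 - (W u x)⁻¹) =
      volume.real (Ω s) - ∫ x in Ω s, (W u x)⁻¹ := fun s => by
    rw [integral_sub (hone.mono_set (hΩD s)) (hinvint.mono_set (hΩD s))]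
    simp
  have hdef0 : ∀ x, 0 ≤ 1 - (W u x)⁻¹ := fun x => sub_nonneg.2 (hinv1 x)
  have hdefint : IntegrableOn (fun x => 1 - (W u x)⁻¹) D := hone.sub hinvint
  set κ := ∫ x in Ω (h / 2), (1 - (W u x)⁻¹)
  have hκpos : 0 < κ := by
    have hopen : IsOpen ((D ∩ (fun x => -u x) ⁻¹' Ioi (h / 2)) ∩ gradient u ⁻¹' {0}ᶜ) :=
      (hgc.mono inter_subset_left).isOpen_inter_preimage (hlevel _) isOpen_compl_singleton
    have hne : ((D ∩ (fun x => -u x) ⁻¹' Ioi (h / 2)) ∩ gradient u ⁻¹' {0}ᶜ).Nonempty := by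
      by_contra hempty
      obtain ⟨x, hx, hxt⟩ := hbelow (h / 2) (by linarith)
      have hev : (fun y => (W u y)⁻¹ • gradient u y) =ᶠ[𝓝 x] 0 := by
        filter_upwards [(hlevel (h / 2)).mem_nhds ⟨hx, hxt⟩] with y hy
        have : gradient u y = 0 := by
          by_contra hgy
          exact hempty ⟨y, hy, hgy⟩
        simp [this]
      have heq := hsol.2 x hx
      simp only [div2, hev.fderiv_eq] at heq
      simp at heq
      linarith [W_pos u x]
    refine (setIntegral_pos_iff_support_of_nonneg_ae (.of_forall hdef0)
      (hdefint.mono_set (hΩD _))).2 ((hopen.measure_pos _ hne).trans_le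
        (measure_mono fun x hx => ⟨?_, hx.1.1, le_of_lt hx.1.2⟩))
    have hg : 0 < ‖gradient u x‖ := norm_pos_iff.2 hx.2
    have hW1 : 1 < W u x := Real.lt_sqrt_of_sq_lt (by nlinarith)
    exact (sub_pos.2 (inv_lt_one_of_one_lt₀ hW1)).ne'
  have hVD : ∀ s, volume.real (Ω s) ≤ volume.real D := fun s => measureReal_mono (hΩD s) hDfin
  have hI0 : ∀ s, 0 ≤ ∫ x in Ω s, (W u x)⁻¹ := fun s => integral_nonneg fun x => (hinv0 x).le
  have hκD : κ ≤ volume.real D := by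
    have := hIV (h / 2)
    linarith [hVD (h / 2), hI0 (h / 2)]
  set θ := 1 - κ / (2 * volume.real D) with hθ
  have hθ0 : 0 < θ := by
    rw [hθ, sub_pos, div_lt_one (by positivity)]
    linarith
  have hθ1 : θ < 1 := sub_lt_self _ (by positivity)
  have hlow : ∀ s, s ≤ h / 2 → ∫ x in Ω s, (W u x)⁻¹ ≤ θ * volume.real (Ω s) := fun s hs => by
    have h1 : κ ≤ ∫ x in Ω s, (1 - (W u x)⁻¹) :=
      setIntegral_mono_set (hdefint.mono_set (hΩD s)) (.of_forall hdef0)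
        (hΩanti hs).eventuallyLE
    rw [hIV s] at h1
    have h2 : κ / (2 * volume.real D) * volume.real (Ω s) ≤ κ := by
      rw [div_mul_eq_mul_div, div_le_iff₀ (by positivity)]
      nlinarith [hVD s]
    rw [hθ]
    linarith
  have hhigh : ∀ s, ∫ x in Ω s, (W u x)⁻¹ ≤ 1 * volume.real (Ω s) := fun s => by
    have h1 : 0 ≤ ∫ x in Ω s, (1 - (W u x)⁻¹) := integral_nonneg hdef0
    rw [hIV s] at h1
    linarith
  have hbottom : 4 * Real.pi / θ * (h / 2) ≤ A - S (h / 2) := by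
    have hlim : Tendsto (fun a : ℝ => 4 * Real.pi / θ * (h / 2 - a)) (𝓝[>] 0)
        (𝓝 (4 * Real.pi / θ * (h / 2 - 0))) :=
      (Continuous.tendsto (by fun_prop) 0).mono_left nhdsWithin_le_nhds
    rw [sub_zero] at hlim
    refine le_of_tendsto hlim (mem_of_superset (Ioo_mem_nhdsGT (half_pos hh0)) fun a ha => ?_)
    have := hstrip ha.1 ha.2 (by linarith) hθ0 fun s _ hs => hlow s hs
    simp only [mem_ofPred_eq]
    linarith [hSA a]
  have htop : 4 * Real.pi * (h - h / 2) ≤ S (h / 2) := by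
    have hlim : Tendsto (fun b : ℝ => 4 * Real.pi * (b - h / 2)) (𝓝[<] h)
        (𝓝 (4 * Real.pi * (h - h / 2))) :=
      (Continuous.tendsto (by fun_prop) h).mono_left nhdsWithin_le_nhds
    refine le_of_tendsto hlim (mem_of_superset
      (Ioo_mem_nhdsLT (by linarith : h / 2 < h)) fun b hb => ?_)
    have := hstrip (half_pos hh0) hb.1 hb.2 one_pos fun s _ _ => hhigh s
    rw [div_one] at this
    simp only [mem_ofPred_eq]
    linarith [hS0 b]
  have hstrict : 4 * Real.pi < 4 * Real.pi / θ := by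
    rw [lt_div_iff₀ hθ0]
    nlinarith [Real.pi_pos]
  nlinarith

end Soliton
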